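/- arXiv:1107.5342 — 2 statements merged into one kernel-verified Lean document; each statement's English description precedes it below -/
import Mathlib

section
/- In a finite undirected graph G with matching M, M is a maximum matching if and only if there is no M-augmenting path (an alternating path that begins and ends at distinct unmatched vertices). -/
/-- `M` is a matching in `G`: a set of edges of `G` that are pairwise vertex-disjoint. -/
def IsMatching' {V : Type*} (G : SimpleGraph V) (M : Set (Sym2 V)) : Prop :=
  M ⊆ G.edgeSet ∧ ∀ e ∈ M, ∀ f ∈ M, e ≠ f → ∀ v : V, v ∈ e → v ∉ f

/-- A vertex is saturated (matched) by `M` if it belongs to some edge of `M`. -/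
def IsSaturated {V : Type*} (M : Set (Sym2 V)) (v : V) : Prop :=
  ∃ e ∈ M, v ∈ e

/-- `p` is an `M`-augmenting path in `G`: a path (given by its list of vertices,
all distinct) whose consecutive vertices are adjacent in `G`, whose edges
alternate outside/inside `M` (starting and ending with edges outside `M`),
and whose two (distinct) endpoints are unmatched by `M`. -/
def IsAugmentingPath {V : Type*} (G : SimpleGraph V) (M : Set (Sym2 V))
    (p : List V) : Prop :=
  2 ≤ p.length ∧ p.Nodup ∧ p.Chain' G.Adj ∧
    (∀ u, p.head? = some u → ¬ IsSaturated M u) ∧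
    (∀ w, p.getLast? = some w → ¬ IsSaturated M w) ∧
    ∀ i : ℕ, ∀ h : i + 1 < p.length,
      (s(p.get ⟨i, Nat.lt_of_succ_lt h⟩, p.get ⟨i + 1, h⟩) ∈ M ↔ i % 2 = 1)

section Matchings

variable {V : Type*} {G : SimpleGraph V} {M N : Set (Sym2 V)}

theorem IsMatching'.eq_of_mem (hM : IsMatching' G M) {e f : Sym2 V} {v : V}
    (he : e ∈ M) (hf : f ∈ M) (hve : v ∈ e) (hvf : v ∈ f) : e = f := by
  by_contra h
  exact hM.2 e he f hf h v hve hvf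

theorem IsMatching'.mono (hM : IsMatching' G M) (h : N ⊆ M) : IsMatching' G N :=
  ⟨h.trans hM.1, fun e he f hf => hM.2 e (h he) f (h hf)⟩

theorem IsMatching'.insert (hM : IsMatching' G M) {a b : V} (hab : G.Adj a b)
    (ha : ¬ IsSaturated M a) (hb : ¬ IsSaturated M b) :
    IsMatching' G (Insert.insert s(a, b) M) := by
  have key : ∀ e ∈ M, ∀ v ∈ s(a, b), v ∉ e := by
    intro e he v hv hve
    rcases Sym2.mem_iff.1 hv with rfl | rfl
    exacts [ha ⟨e, he, hve⟩, hb ⟨e, he, hve⟩]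
  refine ⟨Set.insert_subset hab hM.1, ?_⟩
  rintro e (rfl | he) f (rfl | hf) hne v hve hvf
  · exact hne rfl
  · exact key f hf v hve hvf
  · exact key e he v hvf hve
  · exact hM.2 e he f hf hne v hve hvf

theorem IsSaturated.mono (h : N ⊆ M) {v : V} (hv : IsSaturated N v) : IsSaturated M v :=
  let ⟨e, he, hve⟩ := hv
  ⟨e, h he, hve⟩

theorem IsMatching'.not_isSaturated_diff (hM : IsMatching' G M) {e : Sym2 V} (he : e ∈ M)
    {v : V} (hv : v ∈ e) : ¬ IsSaturated (M \ {e}) v := by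
  rintro ⟨f, hf, hvf⟩
  exact hf.2 (hM.eq_of_mem hf.1 he hvf hv)

theorem isSaturated_diff_iff {e : Sym2 V} {v : V} (hv : v ∉ e) :
    IsSaturated (M \ {e}) v ↔ IsSaturated M v := by
  refine ⟨IsSaturated.mono Set.sdiff_subset, ?_⟩
  rintro ⟨f, hf, hvf⟩
  exact ⟨f, ⟨hf, by rintro rfl; exact hv hvf⟩, hvf⟩

theorem isSaturated_insert_iff {e : Sym2 V} {v : V} :
    IsSaturated (Insert.insert e M) v ↔ v ∈ e ∨ IsSaturated M v := by
  simp [IsSaturated]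

theorem IsMatching'.card_biUnion_toFinset [DecidableEq V] {M : Finset (Sym2 V)}
    (hM : IsMatching' G (M : Set (Sym2 V))) :
    (M.biUnion Sym2.toFinset).card = 2 * M.card := by
  rw [Finset.card_biUnion]
  · rw [Finset.sum_congr rfl fun e he =>
      Sym2.card_toFinset_of_not_isDiag e (G.not_isDiag_of_mem_edgeSet (hM.1 he))]
    simp [mul_comm]
  · intro e he f hf hne
    refine Finset.disjoint_left.2 ?_
    intro v hv hv'
    exact hM.2 e he f hf hne v (Sym2.mem_toFinset.1 hv) (Sym2.mem_toFinset.1 hv')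

theorem exists_isSaturated_of_card_lt [DecidableEq V] {M N : Finset (Sym2 V)}
    (hM : IsMatching' G (M : Set (Sym2 V))) (hN : IsMatching' G (N : Set (Sym2 V)))
    (h : M.card < N.card) :
    ∃ v, IsSaturated (N : Set (Sym2 V)) v ∧ ¬ IsSaturated (M : Set (Sym2 V)) v := by
  have hlt : (M.biUnion Sym2.toFinset).card < (N.biUnion Sym2.toFinset).card := by
    rw [hM.card_biUnion_toFinset, hN.card_biUnion_toFinset]
    omega
  obtain ⟨v, hvN, hvM⟩ := Finset.exists_mem_notMem_of_card_lt_card hlt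
  exact ⟨v, by simpa [IsSaturated] using hvN, by simpa [IsSaturated] using hvM⟩

end Matchings

section AugmentingPaths

variable {V : Type*} {G : SimpleGraph V} {M N : Set (Sym2 V)}

theorem IsAugmentingPath.isSaturated_getElem {p : List V} (hp : IsAugmentingPath G M p) {i : ℕ}
    (hi : 0 < i) (hi' : i + 1 < p.length) : IsSaturated M p[i] := by
  obtain ⟨-, -, -, -, -, halt⟩ := hp
  rcases Nat.mod_two_eq_zero_or_one i with h | h
  · obtain ⟨j, rfl⟩ : ∃ j, i = j + 1 := ⟨i - 1, by omega⟩
    exact ⟨_, (halt j (by omega)).2 (by omega), by simp⟩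
  · exact ⟨_, (halt i hi').2 h, by simp⟩

theorem IsAugmentingPath.even_length {p : List V} (hp : IsAugmentingPath G M p) :
    Even p.length := by
  obtain ⟨hlen, -, -, -, hlast, halt⟩ := hp
  by_contra hodd
  rw [Nat.even_iff] at hodd
  obtain ⟨n, hn⟩ : ∃ n, p.length = n + 2 := ⟨p.length - 2, by omega⟩
  refine hlast p[n + 1] ?_ ⟨_, (halt n (by omega)).2 (by omega), by simp⟩
  simp [List.getLast?_eq_getElem?, hn]

theorem IsAugmentingPath.reverse {p : List V} (hp : IsAugmentingPath G M p) :
    IsAugmentingPath G M p.reverse := by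
  have heven := Nat.even_iff.1 hp.even_length
  obtain ⟨hlen, hnd, hadj, hhead, hlast, halt⟩ := hp
  refine ⟨by simpa, by simpa, ?_, by simpa using hlast, by simpa using hhead, ?_⟩
  · exact List.isChain_reverse.2 (hadj.imp fun _ _ h => h.symm)
  · intro i hi
    simp only [List.length_reverse] at hi
    have := halt (p.length - 1 - (i + 1)) (by omega)
    simp only [List.get_eq_getElem, List.getElem_reverse] at this ⊢
    rw [Sym2.eq_swap]
    have h : p.length - 1 - (i + 1) + 1 = p.length - 1 - i := by omega
    simp only [h] at this
    rw [this]
    omega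

theorem IsAugmentingPath.head_or_getLast_of_mem {p : List V} (hp : IsAugmentingPath G M p)
    {v : V} (hv : v ∈ p) (hs : ¬ IsSaturated M v) : p.head? = some v ∨ p.getLast? = some v := by
  obtain ⟨i, hi, rfl⟩ := List.getElem_of_mem hv
  by_contra! h
  refine hs (hp.isSaturated_getElem (Nat.pos_of_ne_zero ?_) (lt_of_le_of_ne hi ?_))
  · rintro rfl
    exact h.1 (by simp [List.head?_eq_getElem?])
  · intro h'
    refine h.2 ?_
    rw [List.getLast?_eq_getElem?]
    simp [← h']

theorem IsAugmentingPath.congr {p : List V} (hp : IsAugmentingPath G M p)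
    (h : ∀ v ∈ p, ∀ e, v ∈ e → (e ∈ M ↔ e ∈ N)) : IsAugmentingPath G N p := by
  have hsat : ∀ v ∈ p, IsSaturated N v → IsSaturated M v := fun v hv ⟨e, he, hve⟩ =>
    ⟨e, (h v hv e hve).2 he, hve⟩
  obtain ⟨hlen, hnd, hadj, hhead, hlast, halt⟩ := hp
  refine ⟨hlen, hnd, hadj, fun u hu hs => hhead u hu (hsat u (List.mem_of_head? hu) hs),
    fun w hw hs => hlast w hw (hsat w (List.mem_of_getLast? hw) hs), fun i hi => ?_⟩
  rw [← halt i hi]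
  exact (h (p.get ⟨i, Nat.lt_of_succ_lt hi⟩) (List.get_mem _ _) _ (Sym2.mem_mk_left _ _)).symm

/-- Prepending `a, b` to a path that augments the matching without its edge `s(b, c)`. -/
theorem IsAugmentingPath.cons_cons {a b c : V} {t : List V} (hM : IsMatching' G M)
    (hp : IsAugmentingPath G (M \ {s(b, c)}) (c :: t)) (hab : G.Adj a b) (hbc : s(b, c) ∈ M)
    (ha : ¬ IsSaturated M a) (hap : a ∉ c :: t) (hbp : b ∉ c :: t) :
    IsAugmentingPath G M (a :: b :: c :: t) := by
  obtain ⟨hlen, hnd, hadj, -, hlast, halt⟩ := hp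
  refine ⟨by simp, ?_, ?_, by simpa using ha, ?_, ?_⟩
  · rw [List.nodup_cons, List.nodup_cons]
    exact ⟨by simp only [List.mem_cons] at hap ⊢; grind [hab.ne], hbp, hnd⟩
  · exact List.isChain_cons_cons.2 ⟨hab, List.isChain_cons_cons.2 ⟨hM.1 hbc, hadj⟩⟩
  · intro w hw
    simp only [List.getLast?_cons_cons] at hw
    have hwp : w ∈ c :: t := List.mem_of_getLast? hw
    rw [← isSaturated_diff_iff (e := s(b, c))]
    · exact hlast w hw
    · rw [Sym2.mem_iff]
      rintro (rfl | rfl)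
      · exact hbp hwp
      · cases t with
        | nil => simp at hlen
        | cons d t =>
          rw [List.getLast?_cons_cons] at hw
          exact (List.nodup_cons.1 hnd).1 (List.mem_of_getLast? hw)
  · rintro (_ | _ | i) hi
    · simpa using fun h => ha ⟨_, h, by simp⟩
    · simpa using hbc
    · have hi' : i + 1 < (c :: t).length := by simpa using hi
      have := halt i hi'
      have hne : s((c :: t).get ⟨i, Nat.lt_of_succ_lt hi'⟩, (c :: t).get ⟨i + 1, hi'⟩)
          ≠ s(b, c) := by
        intro h
        have hb : b ∈ s((c :: t).get ⟨i, Nat.lt_of_succ_lt hi'⟩, (c :: t).get ⟨i + 1, hi'⟩) :=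
          h ▸ Sym2.mem_mk_left b c
        rcases Sym2.mem_iff.1 hb with rfl | rfl
        exacts [hbp (List.get_mem _ _), hbp (List.get_mem _ _)]
      rw [Set.mem_sdiff, Set.mem_singleton_iff, and_iff_left hne] at this
      exact this.trans (by omega)

/-- The tail of an augmenting path after two vertices augments the exchanged matching. -/
theorem IsAugmentingPath.tail_tail {a b c d : V} {t : List V} (hM : IsMatching' G M)
    (hp : IsAugmentingPath G M (a :: b :: c :: d :: t)) :
    IsAugmentingPath G (Insert.insert s(a, b) (M \ {s(b, c)})) (c :: d :: t) := by
  obtain ⟨-, hnd, hadj, -, hlast, halt⟩ := hp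
  have hbc : s(b, c) ∈ M := by simpa using halt 1 (by simp)
  rw [List.nodup_cons, List.nodup_cons] at hnd
  obtain ⟨hap, hbp, hnd⟩ := hnd
  replace hap : a ∉ c :: d :: t := fun h => hap (List.mem_cons_of_mem _ h)
  have hnot : ∀ v ∈ c :: d :: t, v ∉ s(a, b) := by
    intro v hv h
    rcases Sym2.mem_iff.1 h with rfl | rfl
    exacts [hap hv, hbp hv]
  refine ⟨by simp, hnd, ?_, ?_, ?_, ?_⟩
  · exact (List.isChain_cons_cons.1 (List.isChain_cons_cons.1 hadj).2).2
  · simp only [List.head?_cons, Option.some.injEq, forall_eq', isSaturated_insert_iff, not_or]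
    exact ⟨hnot c (by simp), hM.not_isSaturated_diff hbc (by simp)⟩
  · intro w hw
    rw [isSaturated_insert_iff, not_or]
    exact ⟨hnot w (List.mem_of_getLast? hw), fun h =>
      hlast w (by simpa only [List.getLast?_cons_cons] using hw) (h.mono Set.sdiff_subset)⟩
  · intro i hi
    have h := halt (i + 2) (by simpa using hi)
    set x := (c :: d :: t).get ⟨i, Nat.lt_of_succ_lt hi⟩ with hx
    set y := (c :: d :: t).get ⟨i + 1, hi⟩ with hy
    have hxp : x ∈ c :: d :: t := List.get_mem _ _
    have hyp : y ∈ c :: d :: t := List.get_mem _ _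
    change s(x, y) ∈ M ↔ _ at h
    have h1 : s(x, y) ≠ s(a, b) := fun e => hnot x hxp (e ▸ Sym2.mem_mk_left x y)
    have h2 : s(x, y) ≠ s(b, c) := by
      intro e
      rcases Sym2.mem_iff.1 (e ▸ Sym2.mem_mk_left b c : b ∈ s(x, y)) with rfl | rfl
      exacts [hbp hxp, hbp hyp]
    simp only [Set.mem_insert_iff, Set.mem_sdiff, Set.mem_singleton_iff, h1, h2, false_or,
      not_false_eq_true, and_true, h]
    omega

end AugmentingPaths

theorem IsAugmentingPath.exists_card_lt {V : Type*} [DecidableEq V] {G : SimpleGraph V} :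
    ∀ (p : List V) {M : Finset (Sym2 V)}, IsMatching' G (M : Set (Sym2 V)) →
      IsAugmentingPath G (M : Set (Sym2 V)) p →
      ∃ N : Finset (Sym2 V), IsMatching' G (N : Set (Sym2 V)) ∧ M.card < N.card
  | [], _, _, hp => absurd hp.1 (by simp)
  | [_], _, _, hp => absurd hp.1 (by simp)
  | [_, _, _], _, _, hp => absurd hp.even_length (by simp; decide)
  | [a, b], M, hM, hp => by
    obtain ⟨-, -, hadj, hhead, hlast, -⟩ := hp
    have ha : ¬ IsSaturated (M : Set (Sym2 V)) a := hhead a rfl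
    refine ⟨insert s(a, b) M, ?_, ?_⟩
    · rw [Finset.coe_insert]
      exact hM.insert (List.isChain_cons_cons.1 hadj).1 ha (hlast b rfl)
    · rw [Finset.card_insert_of_notMem fun h => ha ⟨_, h, by simp⟩]
      exact Nat.lt_succ_self _
  | a :: b :: c :: d :: t, M, hM, hp => by
    have htail := hp.tail_tail hM
    obtain ⟨-, -, hadj, hhead, -, halt⟩ := hp
    have ha : ¬ IsSaturated (M : Set (Sym2 V)) a := hhead a rfl
    have hbc : s(b, c) ∈ M := by simpa using halt 1 (by simp)
    have hmatch := (hM.mono (Set.sdiff_subset (t := {s(b, c)}))).insert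
      (List.isChain_cons_cons.1 hadj).1 (fun h => ha (h.mono Set.sdiff_subset))
      (hM.not_isSaturated_diff hbc (by simp))
    rw [← Finset.coe_erase, ← Finset.coe_insert] at htail hmatch
    obtain ⟨N, hN, hcard⟩ := exists_card_lt (c :: d :: t) hmatch htail
    refine ⟨N, hN, lt_of_eq_of_lt ?_ hcard⟩
    rw [Finset.card_insert_of_notMem fun h => ha ⟨_, Finset.mem_of_mem_erase h, by simp⟩,
      Finset.card_erase_add_one hbc]

theorem exists_isAugmentingPath_of_card_lt {V : Type*} [DecidableEq V] {G : SimpleGraph V}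
    (M N : Finset (Sym2 V)) (hM : IsMatching' G (M : Set (Sym2 V)))
    (hN : IsMatching' G (N : Set (Sym2 V))) (hcard : M.card < N.card) :
    ∃ p, IsAugmentingPath G (M : Set (Sym2 V)) p ∧
      ∀ v ∈ p, IsSaturated (M : Set (Sym2 V)) v ∨ IsSaturated (N : Set (Sym2 V)) v := by
  obtain ⟨a, ⟨e, he, hae⟩, haM⟩ := exists_isSaturated_of_card_lt hM hN hcard
  obtain ⟨b, rfl⟩ := hae
  have hab : G.Adj a b := hN.1 he
  by_cases hbM : IsSaturated (M : Set (Sym2 V)) b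
  swap
  · refine ⟨[a, b], ⟨by simp, by simpa using hab.ne, List.isChain_pair.2 hab, by simpa using haM,
      by simpa using hbM, ?_⟩, ?_⟩
    · rintro (_ | i) hi
      · simpa using fun h => haM ⟨_, h, by simp⟩
      · simp at hi
    · simpa using ⟨Or.inr ⟨_, he, by simp⟩, Or.inr ⟨_, he, by simp⟩⟩
  obtain ⟨f, hf, c, rfl⟩ := hbM
  have hMe := hM.mono (Set.sdiff_subset (t := {s(b, c)}))
  have hNe := hN.mono (Set.sdiff_subset (t := {s(a, b)}))
  rw [← Finset.coe_erase] at hMe hNe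
  have hlt : (M.erase s(b, c)).card < (N.erase s(a, b)).card := by
    have := Finset.card_erase_add_one (Finset.mem_coe.1 hf)
    have := Finset.card_erase_add_one (Finset.mem_coe.1 he)
    omega
  obtain ⟨p, hp, hpsat⟩ := exists_isAugmentingPath_of_card_lt _ _ hMe hNe hlt
  rw [Finset.coe_erase] at hp
  simp only [Finset.coe_erase] at hpsat
  have hap : a ∉ p := fun h => (hpsat a h).elim (fun h => haM (h.mono Set.sdiff_subset))
    (hN.not_isSaturated_diff he (by simp))
  have hbp : b ∉ p := fun h => (hpsat b h).elim (hM.not_isSaturated_diff hf (by simp))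
    (hN.not_isSaturated_diff he (by simp))
  replace hpsat : ∀ v ∈ p, IsSaturated (M : Set (Sym2 V)) v ∨ IsSaturated (N : Set (Sym2 V)) v :=
    fun v hv => (hpsat v hv).imp (IsSaturated.mono Set.sdiff_subset)
      (IsSaturated.mono Set.sdiff_subset)
  by_cases hcp : c ∈ p
  swap
  · refine ⟨p, hp.congr fun v hv e hve => ?_, hpsat⟩
    rw [Set.mem_sdiff, Set.mem_singleton_iff, and_iff_left]
    rintro rfl
    rcases Sym2.mem_iff.1 hve with rfl | rfl
    exacts [hbp hv, hcp hv]
  obtain ⟨q, hq, hqmem, hqhead⟩ : ∃ q, IsAugmentingPath G ((M : Set (Sym2 V)) \ {s(b, c)}) q ∧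
      (∀ v, v ∈ q ↔ v ∈ p) ∧ q.head? = some c := by
    rcases hp.head_or_getLast_of_mem hcp (hM.not_isSaturated_diff hf (by simp)) with h | h
    · exact ⟨p, hp, fun _ => Iff.rfl, h⟩
    · exact ⟨p.reverse, hp.reverse, fun _ => List.mem_reverse, by simpa using h⟩
  obtain ⟨t, rfl⟩ := List.head?_eq_some_iff.1 hqhead
  refine ⟨a :: b :: c :: t, hq.cons_cons hM hab hf haM (by rwa [hqmem]) (by rwa [hqmem]), ?_⟩
  intro v hv
  rcases List.mem_cons.1 hv with rfl | hv
  · exact Or.inr ⟨_, he, by simp⟩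
  rcases List.mem_cons.1 hv with rfl | hv
  · exact Or.inr ⟨_, he, by simp⟩
  · exact hpsat v ((hqmem v).1 hv)
termination_by N.card
decreasing_by exact Finset.card_erase_lt_of_mem he

/-- Berge's theorem: a matching `M` in a finite graph `G` is maximum iff
there is no `M`-augmenting path. -/
theorem berge {V : Type*} [Fintype V] [DecidableEq V] (G : SimpleGraph V)
    (M : Finset (Sym2 V)) (hM : IsMatching' G ↑M) :
    (∀ M' : Finset (Sym2 V), IsMatching' G ↑M' → M'.card ≤ M.card) ↔
      ¬ ∃ p : List V, IsAugmentingPath G (↑M) p := by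
  constructor
  · rintro h ⟨p, hp⟩
    obtain ⟨N, hN, hlt⟩ := hp.exists_card_lt p hM
    exact (h N hN).not_gt hlt
  · intro h N hN
    by_contra! hlt
    obtain ⟨p, hp, -⟩ := exists_isAugmentingPath_of_card_lt M N hM hN hlt
    exact h ⟨p, hp⟩
end

section
/- A chordal graph that is not complete has at least two nonadjacent simplicial vertices. -/
/-- A vertex is simplicial if its neighborhood induces a clique. -/
def IsSimplicial {V : Type*} (G : SimpleGraph V) (v : V) : Prop :=
  ∀ x ∈ G.neighborSet v, ∀ y ∈ G.neighborSet v, x ≠ y → G.Adj x y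

namespace SimpleGraph

variable {V : Type*} {G : SimpleGraph V}

/-- The vertices of any walk contain those of a chordless path with the same endpoints. -/
theorem Walk.exists_isPath_isChordless {x y : V} (p : G.Walk x y) :
    ∃ q : G.Walk x y, q.IsPath ∧ q.IsChordless ∧ q.support ⊆ p.support := by
  classical
  have hex : ∃ n, ∃ q : G.Walk x y, q.support ⊆ p.support ∧ q.length = n :=
    ⟨_, p, List.Subset.refl _, rfl⟩
  obtain ⟨q, hqs, hql⟩ := Nat.find_spec hex
  have hmin (r : G.Walk x y) (hr : r.support ⊆ q.support) : q.length ≤ r.length :=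
    hql ▸ Nat.find_min' hex ⟨r, fun _ hz => hqs (hr hz), rfl⟩
  have hshort (i j : ℕ) (hij : i < j) (hj : j ≤ q.length)
      (h : G.Adj (q.getVert i) (q.getVert j)) : s(q.getVert i, q.getVert j) ∈ q.edges := by
    have hle := hmin ((q.take i).append (.cons h (q.drop j))) (by
      intro z hz
      rw [Walk.mem_support_append_iff, Walk.support_cons, List.mem_cons] at hz
      rcases hz with hz | rfl | hz
      · exact (q.isSubwalk_take i).support_subset hz
      · exact q.getVert_mem_support i
      · exact (q.isSubwalk_drop j).support_subset hz)
    simp only [Walk.length_append, Walk.length_cons, Walk.take_length, Walk.drop_length] at hle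
    obtain rfl : j = i + 1 := by omega
    exact q.mk_mem_edges_iff_exists.2 ⟨i, by omega, rfl⟩
  refine ⟨q, ?_, Walk.isChordless_iff_forall_mem_edges.2 fun a b ha hb hab => ?_, hqs⟩
  · rw [← q.bypass_eq_self_of_length_le_length_bypass (hmin _ q.support_bypass_subset_support)]
    exact q.bypass_isPath
  · obtain ⟨i, rfl, hi⟩ := Walk.mem_support_iff_exists_getVert.1 ha
    obtain ⟨j, rfl, hj⟩ := Walk.mem_support_iff_exists_getVert.1 hb
    rcases lt_trichotomy i j with h | rfl | h
    · exact hshort i j h hj hab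
    · exact (G.irrefl hab).elim
    · rw [Sym2.eq_swap]
      exact hshort j i h hi hab.symm

/-- In a chordal graph, two neighbors of `u` joined by a walk whose other vertices avoid the
closed neighborhood of `u` are adjacent. -/
theorem adj_of_walk_avoiding_neighborSet
    (hchordal : ∀ (u : V) (c : G.Walk u u), c.IsCycle → 4 ≤ c.length →
      ∃ x y : V, x ∈ c.support ∧ y ∈ c.support ∧ G.Adj x y ∧ s(x, y) ∉ c.edges)
    {u x y : V} (hux : G.Adj u x) (huy : G.Adj u y) (hxy : x ≠ y) (p : G.Walk x y)
    (hp : ∀ z ∈ p.support, z = x ∨ z = y ∨ z ≠ u ∧ ¬ G.Adj u z) : G.Adj x y := by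
  by_contra hnadj
  obtain ⟨q, hq, hqc, hqs⟩ := p.exists_isPath_isChordless
  have hqz (z : V) (hz : z ∈ q.support) : z = x ∨ z = y ∨ z ≠ u ∧ ¬ G.Adj u z := hp z (hqs hz)
  have huq : u ∉ q.support := fun h => by
    rcases hqz u h with rfl | rfl | h
    · exact G.irrefl hux
    · exact G.irrefl huy
    · exact h.1 rfl
  have hlen : 2 ≤ q.length := by
    by_contra! h
    interval_cases hl : q.length
    · exact hxy (Walk.eq_of_length_eq_zero hl)
    · exact hnadj (Walk.adj_of_length_eq_one hl)
  have hcyc : (Walk.cons hux (q.concat huy.symm)).IsCycle := by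
    refine (Walk.cons_isCycle_iff _ _).2 ⟨hq.concat huq huy.symm, fun h => ?_⟩
    rw [Walk.edges_concat, List.concat_eq_append, List.mem_append] at h
    rcases h with h | h
    · exact huq (q.fst_mem_support_of_mem_edges h)
    · grind
  have hu (b : V) (hb : b ∈ q.support) (hub : G.Adj u b) : b = x ∨ b = y := by
    have := hqz b hb
    tauto
  obtain ⟨a, b, ha, hb, hab, he⟩ := hchordal u _ hcyc (by simp; omega)
  simp only [Walk.support_cons, Walk.support_concat, Walk.edges_cons, Walk.edges_concat,
    List.concat_eq_append, List.mem_cons, List.mem_append, List.not_mem_nil, or_false] at ha hb he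
  have hmem (z : V) (hz : z = u ∨ z ∈ q.support ∨ z = u) : z = u ∨ z ∈ q.support := by tauto
  rcases hmem a ha with rfl | ha' <;> rcases hmem b hb with rfl | hb'
  · exact G.irrefl hab
  · rcases hu b hb' hab with rfl | rfl <;> simp [Sym2.eq_swap] at he
  · rcases hu a ha' hab.symm with rfl | rfl <;> simp [Sym2.eq_swap] at he
  · exact he (Or.inr (Or.inl (hqc.mem_edges ha' hb' hab)))

/-- In an induced subgraph of a chordal graph, every vertex with a non-neighbor has a
simplicial non-neighbor. -/
theorem exists_simplicial_not_adj
    (hchordal : ∀ (u : V) (c : G.Walk u u), c.IsCycle → 4 ≤ c.length →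
      ∃ x y : V, x ∈ c.support ∧ y ∈ c.support ∧ G.Adj x y ∧ s(x, y) ∉ c.edges)
    (A : Finset V) {u v : V} (hu : u ∈ A) (hv : v ∈ A) (huv : u ≠ v) (hnadj : ¬ G.Adj u v) :
    ∃ w ∈ A, u ≠ w ∧ ¬ G.Adj u w ∧
      ∀ x ∈ A, ∀ y ∈ A, G.Adj w x → G.Adj w y → x ≠ y → G.Adj x y := by
  classical
  induction A using Finset.strongInduction generalizing u v with
  | H A ih =>
  -- `C` is the component of `v` in `A` minus the closed neighborhood of `u`.
  let C : Set V := {c | ∃ p : G.Walk v c, ∀ z ∈ p.support, z ∈ A ∧ z ≠ u ∧ ¬ G.Adj u z}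
  have hC {c : V} (hc : c ∈ C) : c ∈ A ∧ c ≠ u ∧ ¬ G.Adj u c := by
    obtain ⟨p, hp⟩ := hc
    exact hp c p.end_mem_support
  have hvC : v ∈ C := ⟨.nil, by simpa using ⟨hv, huv.symm, hnadj⟩⟩
  have hCext {c z : V} (hc : c ∈ C) (hcz : G.Adj c z) (hz : z ∈ A) (hzC : z ∉ C) :
      G.Adj u z := by
    by_contra hn
    have hzu : z ≠ u := fun h => (hC hc).2.2 (h ▸ hcz.symm)
    obtain ⟨p, hp⟩ := hc
    refine hzC ⟨p.concat hcz, fun t ht => ?_⟩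
    rw [Walk.support_concat, List.mem_append, List.mem_singleton] at ht
    rcases ht with ht | rfl
    · exact hp t ht
    · exact ⟨hz, hzu, hn⟩
  let A' : Finset V := A.filter fun z => z ∈ C ∨ ∃ c ∈ C, G.Adj c z
  have hA' {z : V} : z ∈ A' ↔ z ∈ A ∧ (z ∈ C ∨ ∃ c ∈ C, G.Adj c z) := Finset.mem_filter
  have hCA' {c : V} (hc : c ∈ C) : c ∈ A' := hA'.2 ⟨(hC hc).1, .inl hc⟩
  have hss : A' ⊂ A := by
    refine Finset.filter_ssubset.2 ⟨u, hu, ?_⟩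
    rintro (h | ⟨c, hc, hcu⟩)
    · exact (hC h).2.1 rfl
    · exact (hC hc).2.2 hcu.symm
  have hclique {x y : V} (hx : x ∈ A') (hy : y ∈ A') (hxC : x ∉ C) (hyC : y ∉ C) (hxy : x ≠ y) :
      G.Adj x y := by
    obtain ⟨hxA, hx | ⟨c, hc, hcx⟩⟩ := hA'.1 hx
    · exact (hxC hx).elim
    obtain ⟨hyA, hy | ⟨d, hd, hdy⟩⟩ := hA'.1 hy
    · exact (hyC hy).elim
    have hux := hCext hc hcx hxA hxC
    have huy := hCext hd hdy hyA hyC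
    obtain ⟨p, hp⟩ := hc
    obtain ⟨q, hq⟩ := hd
    refine adj_of_walk_avoiding_neighborSet hchordal hux huy hxy
      (.cons hcx.symm ((p.reverse.append q).concat hdy)) fun z hz => ?_
    simp only [Walk.support_cons, Walk.support_concat, Walk.mem_support_append_iff,
      Walk.support_reverse, List.mem_reverse, List.mem_cons, List.mem_append,
      List.not_mem_nil, or_false] at hz
    rcases hz with hz | (hz | hz) | hz
    · exact .inl hz
    · exact .inr (.inr (hp z hz).2)
    · exact .inr (.inr (hq z hz).2)
    · exact .inr (.inl hz)
  suffices ∃ w ∈ C, ∀ x ∈ A', ∀ y ∈ A', G.Adj w x → G.Adj w y → x ≠ y → G.Adj x y by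
    obtain ⟨w, hw, hs⟩ := this
    obtain ⟨hwA, hwu, hn⟩ := hC hw
    exact ⟨w, hwA, hwu.symm, hn, fun x hx y hy hwx hwy =>
      hs x (hA'.2 ⟨hx, .inr ⟨w, hw, hwx⟩⟩) y (hA'.2 ⟨hy, .inr ⟨w, hw, hwy⟩⟩) hwx hwy⟩
  by_cases hS : ∃ s ∈ A', s ∉ C ∧ ∃ t ∈ A', s ≠ t ∧ ¬ G.Adj s t
  · obtain ⟨s, hs, hsC, t, ht, hst, hn⟩ := hS
    obtain ⟨w, hw, hsw, hnw, h⟩ := ih A' hss hs ht hst hn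
    exact ⟨w, by_contra fun hwC => hnw (hclique hs hw hsC hwC hsw), h⟩
  push Not at hS
  by_cases hK : ∃ a ∈ A', ∃ b ∈ A', a ≠ b ∧ ¬ G.Adj a b
  · obtain ⟨a, ha, b, hb, hab, hn⟩ := hK
    obtain ⟨w, hw, haw, hnw, h⟩ := ih A' hss ha hb hab hn
    exact ⟨w, by_contra fun hwC => hnw (hS w hw hwC a ha haw.symm).symm, h⟩
  · push Not at hK
    exact ⟨v, hvC, fun x hx y hy _ _ hxy => hK x hx y hy hxy⟩

end SimpleGraph

/-- A chordal graph that is not complete has two nonadjacent simplicial vertices. -/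
theorem chordal_two_simplicial {V : Type*} [Fintype V] (G : SimpleGraph V)
    (hchordal : ∀ (u : V) (c : G.Walk u u), c.IsCycle → 4 ≤ c.length →
      ∃ x y : V, x ∈ c.support ∧ y ∈ c.support ∧ G.Adj x y ∧ s(x, y) ∉ c.edges)
    (hnc : ∃ u v : V, u ≠ v ∧ ¬ G.Adj u v) :
    ∃ a b : V, a ≠ b ∧ ¬ G.Adj a b ∧ IsSimplicial G a ∧ IsSimplicial G b := by
  obtain ⟨u, v, huv, hn⟩ := hnc
  obtain ⟨a, -, hua, hna, ha⟩ := G.exists_simplicial_not_adj hchordal Finset.univ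
    (Finset.mem_univ u) (Finset.mem_univ v) huv hn
  obtain ⟨b, -, hab, hnb, hb⟩ := G.exists_simplicial_not_adj hchordal Finset.univ
    (Finset.mem_univ a) (Finset.mem_univ u) hua.symm fun h => hna h.symm
  exact ⟨a, b, hab, hnb,
    fun x hx y hy => ha x (Finset.mem_univ x) y (Finset.mem_univ y) hx hy,
    fun x hx y hy => hb x (Finset.mem_univ x) y (Finset.mem_univ y) hx hy⟩
end
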